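/- Fix any ϱ₁, ϱ₂ > 0. There exists a constant C > 0 depending only on N, γ, ϱ₁ and ϱ₂ such that for every smooth compactly supported function U on ℝ^N (not required to vanish on the hyperplane {x_N = 0}), ∫_0^{ϱ₁} ∫_{B^n(0, ϱ₂)} x_N^{1-2γ} U(x̄, x_N)² dx̄ dx_N ≤ C ∫_{ℝ^N_+} x_N^{1-2γ} |∇U(x)|² dx. -/

import Mathlib

open MeasureTheory Real Filter Topology

theorem lintegral_Ioi_one_rpow_neg {q : ℝ} (hq : 1 < q) :
    ∫⁻ s in Set.Ioi (1 : ℝ), ENNReal.ofReal (s ^ (-q)) = ENNReal.ofReal (1 / (q - 1)) := by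
  rw [← ofReal_integral_eq_lintegral_ofReal
    (integrableOn_Ioi_rpow_of_lt (by linarith) one_pos)
    ((ae_restrict_iff' measurableSet_Ioi).2 (ae_of_all _ fun s hs =>
      rpow_nonneg (zero_le_one.trans (le_of_lt hs)) _)),
    integral_Ioi_rpow_of_lt (by linarith) one_pos, Real.one_rpow]
  congr 1
  rw [neg_div, ← div_neg]
  congr 1
  ring

/-- A one-dimensional weighted Cauchy–Schwarz bound for a function vanishing at infinity. -/
theorem ofReal_sq_le_lintegral_deriv_sq {q : ℝ} (hq : 1 < q) {f f' : ℝ → ℝ}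
    (hf : ∀ s, HasDerivAt f (f' s) s) (hf' : Continuous f') {S : ℝ} (hS : 1 ≤ S) (hfS : f S = 0) :
    ENNReal.ofReal (f 1 ^ 2) ≤ ENNReal.ofReal (1 / (q - 1)) *
      ∫⁻ s in Set.Ioi (1 : ℝ), ENNReal.ofReal (s ^ q * f' s ^ 2) := by
  have hftc : ∫ s in (1 : ℝ)..S, f' s = - f 1 := by
    rw [intervalIntegral.integral_eq_sub_of_hasDerivAt (fun s _ => hf s)
      (hf'.intervalIntegrable _ _), hfS, zero_sub]
  have hle : ‖f 1‖ₑ ≤ ∫⁻ s in Set.Ioi (1 : ℝ), ‖f' s‖ₑ := by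
    rw [← enorm_neg, ← hftc, intervalIntegral.integral_of_le hS]
    exact (enorm_integral_le_lintegral_enorm _).trans
      (lintegral_mono_set Set.Ioc_subset_Ioi_self)
  have hpow (s : ℝ) (hs : 1 < s) (b : ℝ) : (s ^ (b / 2)) ^ 2 = s ^ b := by
    rw [← Real.rpow_mul_natCast (by linarith)]
    congr 1
    push_cast
    ring
  have hmul : ∫⁻ s in Set.Ioi (1 : ℝ), ‖f' s‖ₑ = ∫⁻ s in Set.Ioi (1 : ℝ),
      ((fun s : ℝ => ENNReal.ofReal (s ^ (-q / 2))) *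
        (fun s : ℝ => ENNReal.ofReal (s ^ (q / 2) * |f' s|))) s := by
    refine setLIntegral_congr_fun measurableSet_Ioi fun s (hs : 1 < s) => ?_
    have hs0 : 0 < s := by linarith
    simp only [Pi.mul_apply]
    rw [← ENNReal.ofReal_mul (rpow_nonneg hs0.le _), ← mul_assoc, ← Real.rpow_add hs0, neg_div,
      neg_add_cancel, Real.rpow_zero, one_mul, ← Real.norm_eq_abs, ofReal_norm]
  have hcs := ENNReal.lintegral_mul_le_Lp_mul_Lq (volume.restrict (Set.Ioi (1 : ℝ)))
    Real.HolderConjugate.two_two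
    (f := fun s : ℝ => ENNReal.ofReal (s ^ (-q / 2)))
    (g := fun s : ℝ => ENNReal.ofReal (s ^ (q / 2) * |f' s|))
    (by fun_prop) (by have := hf'.measurable; fun_prop)
  rw [← hmul] at hcs
  have hA : ∫⁻ s in Set.Ioi (1 : ℝ), ENNReal.ofReal (s ^ (-q / 2)) ^ (2 : ℝ)
      = ENNReal.ofReal (1 / (q - 1)) := by
    rw [← lintegral_Ioi_one_rpow_neg hq]
    refine setLIntegral_congr_fun measurableSet_Ioi fun s (hs : 1 < s) => ?_
    have hs0 : 0 < s := by linarith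
    rw [ENNReal.rpow_two, ← ENNReal.ofReal_pow (rpow_nonneg hs0.le _), hpow s hs]
  have hB : ∫⁻ s in Set.Ioi (1 : ℝ), ENNReal.ofReal (s ^ (q / 2) * |f' s|) ^ (2 : ℝ)
      = ∫⁻ s in Set.Ioi (1 : ℝ), ENNReal.ofReal (s ^ q * f' s ^ 2) := by
    refine setLIntegral_congr_fun measurableSet_Ioi fun s (hs : 1 < s) => ?_
    have hs0 : 0 < s := by linarith
    rw [ENNReal.rpow_two, ← ENNReal.ofReal_pow (by positivity), mul_pow, hpow s hs, sq_abs]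
  rw [hA, hB, ← ENNReal.mul_rpow_of_nonneg _ _ (by norm_num)] at hcs
  have h2 := ENNReal.rpow_le_rpow (hle.trans hcs) (zero_le_two (α := ℝ))
  rw [← ENNReal.rpow_mul, one_div_mul_cancel two_ne_zero, ENNReal.rpow_one, ENNReal.rpow_two,
    ← ofReal_norm, ← ENNReal.ofReal_pow (norm_nonneg _), Real.norm_eq_abs, sq_abs] at h2
  exact h2

theorem lintegral_comp_smul_halfspace {E : Type*} [NormedAddCommGroup E] [NormedSpace ℝ E]
    [FiniteDimensional ℝ E] [MeasurableSpace E] [BorelSpace E] (μ : Measure (E × ℝ))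
    [μ.IsAddHaarMeasure] (a : ℝ) (G : E × ℝ → ℝ) {s : ℝ} (hs : 0 < s) :
    ∫⁻ p in {p : E × ℝ | 0 < p.2}, ENNReal.ofReal (p.2 ^ a * G (s • p)) ∂μ =
      ENNReal.ofReal (s ^ (-(Module.finrank ℝ E + 1 + a))) *
        ∫⁻ p in {p : E × ℝ | 0 < p.2}, ENNReal.ofReal (p.2 ^ a * G p) ∂μ := by
  have hH : MeasurableSet {p : E × ℝ | 0 < p.2} := measurableSet_lt (by fun_prop) (by fun_prop)
  have hmap := Measure.map_addHaar_smul μ hs.ne'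
  have key := lintegral_map_equiv (μ := μ)
    ({p : E × ℝ | 0 < p.2}.indicator fun p => ENNReal.ofReal (p.2 ^ a * G p))
    (MeasurableEquiv.smul₀ s hs.ne')
  rw [MeasurableEquiv.coe_smul₀, hmap, lintegral_smul_measure] at key
  rw [← lintegral_indicator hH, ← lintegral_indicator hH]
  have hscale (p : E × ℝ) : ({p : E × ℝ | 0 < p.2}.indicator
      (fun p => ENNReal.ofReal (p.2 ^ a * G (s • p)))) p = ENNReal.ofReal (s ^ (-a)) *
      ({p : E × ℝ | 0 < p.2}.indicator fun p => ENNReal.ofReal (p.2 ^ a * G p)) (s • p) := by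
    by_cases hp : 0 < p.2
    · have hsp : 0 < (s • p).2 := mul_pos hs hp
      rw [Set.indicator_of_mem (by exact hp), Set.indicator_of_mem (by exact hsp),
        ← ENNReal.ofReal_mul (by positivity)]
      congr 1
      rw [Prod.smul_snd, smul_eq_mul, Real.mul_rpow hs.le hp.le, Real.rpow_neg hs.le]
      field_simp
    · have hsp : ¬ 0 < (s • p).2 := by
        simpa [hs] using hp
      rw [Set.indicator_of_notMem (by exact hp), Set.indicator_of_notMem (by exact hsp), mul_zero]
  simp_rw [hscale]
  rw [lintegral_const_mul' _ _ ENNReal.ofReal_ne_top, ← key, smul_eq_mul, ← mul_assoc,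
    ← ENNReal.ofReal_mul (by positivity), Module.finrank_prod, Module.finrank_self]
  congr 2
  rw [abs_of_pos (by positivity), neg_add_rev, Real.rpow_add hs, ← Nat.cast_add_one,
    Real.rpow_neg hs.le (_ : ℕ), Real.rpow_natCast]

theorem measurableSet_halfspace {E : Type*} [MeasurableSpace E] :
    MeasurableSet {p : E × ℝ | 0 < p.2} :=
  measurableSet_lt measurable_const measurable_snd

theorem measurableSet_cylinder {E : Type*} [NormedAddCommGroup E] [MeasurableSpace E]
    [BorelSpace E] (ϱ₁ ϱ₂ : ℝ) :
    MeasurableSet {p : E × ℝ | 0 < p.2 ∧ p.2 < ϱ₁ ∧ ‖p.1‖ < ϱ₂} :=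
  measurableSet_halfspace.inter ((measurableSet_lt measurable_snd measurable_const).inter
    (measurableSet_lt measurable_fst.norm measurable_const))

/-- The squared gradient norm of a function on a product space, from its two partial gradients. -/
noncomputable def partialGradSq {E : Type*} [NormedAddCommGroup E] [NormedSpace ℝ E]
    (U : E × ℝ → ℝ) (p : E × ℝ) : ℝ :=
  ‖(fderiv ℝ U p).comp (ContinuousLinearMap.inl ℝ E ℝ)‖ ^ 2 + fderiv ℝ U p (0, 1) ^ 2

section partialGradSq

variable {E : Type*} [NormedAddCommGroup E] [NormedSpace ℝ E] {U : E × ℝ → ℝ}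

theorem partialGradSq_nonneg (p : E × ℝ) : 0 ≤ partialGradSq U p := by
  unfold partialGradSq
  positivity

theorem partialGradSq_eq {p : E × ℝ} (hU : DifferentiableAt ℝ U p) :
    ‖fderiv ℝ (fun y => U (y, p.2)) p.1‖ ^ 2 + deriv (fun t => U (p.1, t)) p.2 ^ 2 =
      partialGradSq U p := by
  have h : HasFDerivAt U (fderiv ℝ U p) (p.1, p.2) := hU.hasFDerivAt
  have h1 := HasFDerivAt.comp p.1 h (hasFDerivAt_prodMk_left (𝕜 := ℝ) p.1 p.2)
  have h2 := h.comp_hasDerivAt p.2 ((hasDerivAt_const p.2 p.1).prodMk (hasDerivAt_id p.2))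
  unfold partialGradSq
  rw [← h1.fderiv, ← h2.deriv]
  rfl

theorem continuous_partialGradSq (hU : ContDiff ℝ 1 U) : Continuous (partialGradSq U) := by
  have h := hU.continuous_fderiv one_ne_zero
  unfold partialGradSq
  fun_prop

theorem HasCompactSupport.partialGradSq (hU : HasCompactSupport U) :
    HasCompactSupport (partialGradSq U) := by
  refine (hU.fderiv (𝕜 := ℝ)).mono fun p hp hp0 => hp ?_
  simp [_root_.partialGradSq, hp0]

theorem fderiv_apply_sq_le (p v : E × ℝ) :
    fderiv ℝ U p v ^ 2 ≤ (‖v.1‖ ^ 2 + v.2 ^ 2) * partialGradSq U p := by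
  have hv : fderiv ℝ U p v = (fderiv ℝ U p).comp (ContinuousLinearMap.inl ℝ E ℝ) v.1
      + v.2 * fderiv ℝ U p (0, 1) := by
    rw [ContinuousLinearMap.comp_apply, ContinuousLinearMap.inl_apply, ← smul_eq_mul, ← map_smul,
      ← map_add]
    simp
  have h1 := ((fderiv ℝ U p).comp (ContinuousLinearMap.inl ℝ E ℝ)).le_opNorm v.1
  rw [Real.norm_eq_abs] at h1
  have h2 : |fderiv ℝ U p v| ≤
      ‖(fderiv ℝ U p).comp (ContinuousLinearMap.inl ℝ E ℝ)‖ * ‖v.1‖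
        + |v.2| * |fderiv ℝ U p (0, 1)| := by
    rw [hv, ← abs_mul]
    exact (abs_add_le _ _).trans (by gcongr)
  unfold partialGradSq
  rw [← sq_abs, ← sq_abs v.2, ← sq_abs (fderiv ℝ U p (0, 1))]
  refine (pow_le_pow_left₀ (abs_nonneg _) h2 2).trans ?_
  nlinarith [sq_nonneg (‖(fderiv ℝ U p).comp (ContinuousLinearMap.inl ℝ E ℝ)‖ * |v.2|
    - ‖v.1‖ * |fderiv ℝ U p (0, 1)|)]

/-- Radial estimate along the ray through `p`. -/
theorem ofReal_sq_le_lintegral_ray {q : ℝ} (hq : 1 < q) (hU : ContDiff ℝ 1 U)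
    (hUc : HasCompactSupport U) {p : E × ℝ} (hp : p ≠ 0) :
    ENNReal.ofReal (U p ^ 2) ≤ ENNReal.ofReal (1 / (q - 1)) * ∫⁻ s in Set.Ioi (1 : ℝ),
      ENNReal.ofReal (s ^ q * ((‖p.1‖ ^ 2 + p.2 ^ 2) * partialGradSq U (s • p))) := by
  obtain ⟨R, hR⟩ := hUc.isCompact.isBounded.subset_ball 0
  have hnp : 0 < ‖p‖ := norm_pos_iff.2 hp
  set S := max 1 (R / ‖p‖) with hSdef
  have hS1 : 1 ≤ S := le_max_left _ _
  have hS : U (S • p) = 0 := by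
    refine image_eq_zero_of_notMem_tsupport fun hmem => ?_
    have := hR hmem
    rw [mem_ball_zero_iff, norm_smul, Real.norm_of_nonneg (by linarith), ← lt_div_iff₀ hnp] at this
    exact this.not_ge (le_max_right _ _)
  have hd (s : ℝ) : HasDerivAt (fun s : ℝ => U (s • p)) (fderiv ℝ U (s • p) p) s := by
    have h1 : HasDerivAt (fun s : ℝ => s • p) p s := by
      simpa using (hasDerivAt_id s).smul_const p
    exact ((hU.differentiable one_ne_zero) (s • p)).hasFDerivAt.comp_hasDerivAt s h1
  have hc : Continuous fun s : ℝ => fderiv ℝ U (s • p) p := by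
    have h := hU.continuous_fderiv one_ne_zero
    fun_prop
  have key := ofReal_sq_le_lintegral_deriv_sq hq hd hc hS1 hS
  rw [one_smul] at key
  refine key.trans ?_
  refine mul_le_mul_right (setLIntegral_mono' measurableSet_Ioi fun s (hs : 1 < s) => ?_) _
  have hs0 : 0 < s := by linarith
  gcongr
  exact fderiv_apply_sq_le _ _

variable [FiniteDimensional ℝ E] [MeasurableSpace E] [BorelSpace E]

theorem lintegral_cylinder_le (μ : Measure (E × ℝ)) [μ.IsAddHaarMeasure] {a q : ℝ} (hq : 1 < q)
    (hqa : 2 * q = Module.finrank ℝ E + 1 + a) (hU : ContDiff ℝ 1 U) (hUc : HasCompactSupport U)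
    {ϱ₁ ϱ₂ : ℝ} :
    ∫⁻ p in {p : E × ℝ | 0 < p.2 ∧ p.2 < ϱ₁ ∧ ‖p.1‖ < ϱ₂}, ENNReal.ofReal (p.2 ^ a * U p ^ 2) ∂μ ≤
      ENNReal.ofReal ((1 / (q - 1)) ^ 2 * (ϱ₂ ^ 2 + ϱ₁ ^ 2)) *
        ∫⁻ p in {p : E × ℝ | 0 < p.2}, ENNReal.ofReal (p.2 ^ a * partialGradSq U p) ∂μ := by
  set G := partialGradSq U
  set K := 1 / (q - 1)
  have hK : 0 < K := one_div_pos.2 (by linarith)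
  set M := ϱ₂ ^ 2 + ϱ₁ ^ 2
  have hM : 0 ≤ M := by positivity
  have hGm : Measurable G := (continuous_partialGradSq hU).measurable
  have hZ := measurableSet_cylinder (E := E) ϱ₁ ϱ₂
  calc
    _ ≤ ∫⁻ p in {p : E × ℝ | 0 < p.2 ∧ p.2 < ϱ₁ ∧ ‖p.1‖ < ϱ₂}, (∫⁻ s in Set.Ioi (1 : ℝ),
        ENNReal.ofReal (K * M * s ^ q) * ENNReal.ofReal (p.2 ^ a * G (s • p))) ∂μ := by
      refine setLIntegral_mono' hZ fun p ⟨hp0, hp1, hp2⟩ => ?_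
      have hp : p ≠ 0 := fun h => by simp [h] at hp0
      rw [ENNReal.ofReal_mul (by positivity)]
      refine (mul_le_mul_right (ofReal_sq_le_lintegral_ray hq hU hUc hp) _).trans ?_
      rw [← mul_assoc, ← ENNReal.ofReal_mul (by positivity),
        ← lintegral_const_mul' _ _ ENNReal.ofReal_ne_top]
      refine setLIntegral_mono' measurableSet_Ioi fun s (hs : 1 < s) => ?_
      have hs0 : 0 < s := by linarith
      have hG0 : 0 ≤ G (s • p) := partialGradSq_nonneg _
      rw [← ENNReal.ofReal_mul (by positivity), ← ENNReal.ofReal_mul (by positivity)]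
      refine ENNReal.ofReal_le_ofReal ?_
      have hpM : ‖p.1‖ ^ 2 + p.2 ^ 2 ≤ M :=
        add_le_add (pow_le_pow_left₀ (norm_nonneg _) hp2.le 2) (pow_le_pow_left₀ hp0.le hp1.le 2)
      calc
        _ = K * (‖p.1‖ ^ 2 + p.2 ^ 2) * s ^ q * (p.2 ^ a * G (s • p)) := by ring
        _ ≤ _ := by gcongr
    _ ≤ ∫⁻ p in {p : E × ℝ | 0 < p.2}, (∫⁻ s in Set.Ioi (1 : ℝ),
        ENNReal.ofReal (K * M * s ^ q) * ENNReal.ofReal (p.2 ^ a * G (s • p))) ∂μ :=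
      lintegral_mono_set fun p hp => hp.1
    _ = ∫⁻ s in Set.Ioi (1 : ℝ), ∫⁻ p in {p : E × ℝ | 0 < p.2},
        ENNReal.ofReal (K * M * s ^ q) * ENNReal.ofReal (p.2 ^ a * G (s • p)) ∂μ := by
      refine lintegral_lintegral_swap (Measurable.aemeasurable ?_)
      have h : Measurable fun z : (E × ℝ) × ℝ => G (z.2 • z.1) :=
        hGm.comp (measurable_snd.smul measurable_fst)
      unfold Function.uncurry
      fun_prop
    _ = ∫⁻ s in Set.Ioi (1 : ℝ), ENNReal.ofReal (K * M) * (ENNReal.ofReal (s ^ (-q)) *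
        ∫⁻ p in {p : E × ℝ | 0 < p.2}, ENNReal.ofReal (p.2 ^ a * G p) ∂μ) := by
      refine setLIntegral_congr_fun measurableSet_Ioi fun s (hs : 1 < s) => ?_
      have hs0 : 0 < s := by linarith
      rw [lintegral_const_mul' _ _ ENNReal.ofReal_ne_top, lintegral_comp_smul_halfspace μ a G hs0,
        ← hqa, ENNReal.ofReal_mul (by positivity), mul_assoc, ← mul_assoc (ENNReal.ofReal (s ^ q)),
        ← ENNReal.ofReal_mul (by positivity), ← Real.rpow_add hs0]
      ring_nf
    _ = _ := by
      rw [lintegral_const_mul' _ _ ENNReal.ofReal_ne_top, lintegral_mul_const _ (by fun_prop),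
        lintegral_Ioi_one_rpow_neg hq, ← mul_assoc, ← ENNReal.ofReal_mul (by positivity)]
      congr 2
      ring

end partialGradSq

/-- A power weight `t ^ a` with `a > -1` is integrable on a half-space against continuous
compactly supported functions. -/
theorem integrableOn_halfspace_rpow_mul {E : Type*} [NormedAddCommGroup E]
    [NormedSpace ℝ E] [FiniteDimensional ℝ E] [MeasurableSpace E] [BorelSpace E]
    (μ : Measure E) [IsFiniteMeasureOnCompacts μ] [SFinite μ] {a : ℝ} (ha : -1 < a)
    {G : E × ℝ → ℝ} (hG : Continuous G) (hGc : HasCompactSupport G) :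
    IntegrableOn (fun p : E × ℝ => p.2 ^ a * G p) {p | 0 < p.2} (μ.prod volume) := by
  obtain ⟨R, hR⟩ := hGc.isCompact.isBounded.subset_closedBall 0
  obtain ⟨B, hB⟩ := hG.bounded_above_of_compact_support hGc
  have hw : IntegrableOn (fun p : E × ℝ => p.2 ^ a)
      (Metric.closedBall 0 R ×ˢ Set.Ioc 0 R) (μ.prod volume) := by
    have h1 : IntegrableOn (fun _ : E => (1 : ℝ)) (Metric.closedBall 0 R) μ :=
      integrableOn_const (isCompact_closedBall _ _).measure_ne_top
    have h2 : IntegrableOn (fun t : ℝ => t ^ a) (Set.Ioc 0 R) :=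
      (intervalIntegral.intervalIntegrable_rpow' ha).1
    have h3 := Integrable.mul_prod h1 h2
    rw [Measure.prod_restrict] at h3
    simpa only [IntegrableOn, one_mul] using h3
  refine IntegrableOn.of_forall_sdiff_eq_zero (hw.mul_bdd hG.aestronglyMeasurable (ae_of_all _ hB))
    measurableSet_halfspace fun p ⟨hp0, hp⟩ => ?_
  suffices hGp : G p = 0 by rw [hGp, mul_zero]
  refine image_eq_zero_of_notMem_tsupport fun hmem => hp ?_
  have h := mem_closedBall_zero_iff.1 (hR hmem)
  exact ⟨mem_closedBall_zero_iff.2 ((norm_fst_le p).trans h), hp0,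
    (Real.le_norm_self _).trans ((norm_snd_le p).trans h)⟩

theorem stmt_3 (n : ℕ) (γ : ℝ) (hγ0 : 0 < γ) (hγ1 : γ < 1) (hn : 2 * γ < (n : ℝ))
    (ϱ₁ ϱ₂ : ℝ) (hϱ₁ : 0 < ϱ₁) (hϱ₂ : 0 < ϱ₂) :
    ∃ C : ℝ, 0 < C ∧
      ∀ U : EuclideanSpace ℝ (Fin n) × ℝ → ℝ,
        ContDiff ℝ (⊤ : ℕ∞) U → HasCompactSupport U →
        (∫ p in {p : EuclideanSpace ℝ (Fin n) × ℝ |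
              0 < p.2 ∧ p.2 < ϱ₁ ∧ ‖p.1‖ < ϱ₂},
            p.2 ^ (1 - 2 * γ) * (U p) ^ 2) ≤
          C * ∫ p in {p : EuclideanSpace ℝ (Fin n) × ℝ | 0 < p.2},
              p.2 ^ (1 - 2 * γ) *
                (‖fderiv ℝ (fun y => U (y, p.2)) p.1‖ ^ 2 +
                  (deriv (fun t => U (p.1, t)) p.2) ^ 2) := by
  set q : ℝ := 1 + (n - 2 * γ) / 2 with hqdef
  have hq : 1 < q := by linarith
  have hC : 0 < (1 / (q - 1)) ^ 2 * (ϱ₂ ^ 2 + ϱ₁ ^ 2) := by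
    have := sub_pos.2 hq
    positivity
  refine ⟨(1 / (q - 1)) ^ 2 * (ϱ₂ ^ 2 + ϱ₁ ^ 2), hC, fun U hU hUc => ?_⟩
  have hU1 : ContDiff ℝ 1 U := hU.of_le (by exact_mod_cast le_top)
  simp_rw [fun p => partialGradSq_eq ((hU1.differentiable one_ne_zero) p)]
  have hint : IntegrableOn (fun p : EuclideanSpace ℝ (Fin n) × ℝ =>
      p.2 ^ (1 - 2 * γ) * partialGradSq U p) {p | 0 < p.2} volume :=
    integrableOn_halfspace_rpow_mul volume (by linarith) (continuous_partialGradSq hU1)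
      hUc.partialGradSq
  have hnn : ∀ p ∈ {p : EuclideanSpace ℝ (Fin n) × ℝ | 0 < p.2},
      0 ≤ p.2 ^ (1 - 2 * γ) * partialGradSq U p := fun p hp =>
    mul_nonneg (rpow_nonneg (le_of_lt hp) _) (partialGradSq_nonneg p)
  have hZ := measurableSet_cylinder (E := EuclideanSpace ℝ (Fin n)) ϱ₁ ϱ₂
  have hUm : Measurable U := hU1.continuous.measurable
  have key := lintegral_cylinder_le (U := U)
    ((volume : Measure (EuclideanSpace ℝ (Fin n))).prod (volume : Measure ℝ))
    (a := 1 - 2 * γ) hq (by rw [finrank_euclideanSpace_fin, hqdef]; ring) hU1 hUc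
    (ϱ₁ := ϱ₁) (ϱ₂ := ϱ₂)
  rw [← Measure.volume_eq_prod] at key
  rw [← ofReal_integral_eq_lintegral_ofReal hint
    ((ae_restrict_iff' measurableSet_halfspace).2 (ae_of_all _ hnn)),
    ← ENNReal.ofReal_mul hC.le] at key
  rw [integral_eq_lintegral_of_nonneg_ae ((ae_restrict_iff' hZ).2 (ae_of_all _ fun p hp =>
    mul_nonneg (rpow_nonneg (le_of_lt hp.1) _) (sq_nonneg _)))
    (Measurable.aestronglyMeasurable (by fun_prop))]
  exact ENNReal.toReal_le_of_le_ofReal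
    (mul_nonneg hC.le (setIntegral_nonneg measurableSet_halfspace hnn)) key
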